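/- arXiv:2504.20503 — 2 statements merged into one kernel-verified Lean document; each statement's English description precedes it below -/
import Mathlib

section
/- Fix an integer d ≥ 2 and a complex number a ≠ 0. Consider configurations (e, p) ∈ (Fin d → ℂ) × (Fin (d−2) → ℂ) of d candidate zeros e_j and d−2 candidate poles p_{k'}, and for a configuration with all 2d−2 coordinates pairwise distinct define the residues η_j(e,p) := (∏_{k'} (e_j − p_{k'})) / (a · ∏_{k ≠ j} (e_j − e_k)). Then the set of configurations (e, p) such that (i) all 2d−2 coordinates e_1, …, e_d, p_1, …, p_{d−2} are pairwise distinct, and (ii) for every subset J ⊆ Fin d with J ≠ ∅ and J ≠ Fin d the real part of ∑_{j ∈ J} η_j(e,p) is nonzero, is open and dense in (Fin d → ℂ) × (Fin (d−2) → ℂ) ≅ ℂ^{2d−2}. -/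
open Finset

/-- The residue `η_j = 1/f'(e_j)` of the rational vector field
`f(w) = a ∏_j (w - e_j) / ∏_{k'} (w - p_{k'})` at its simple zero `e_j`,
for the configuration `c = (e, p)`. -/
noncomputable def rationalResidue (d : ℕ) (a : ℂ)
    (c : (Fin d → ℂ) × (Fin (d - 2) → ℂ)) (j : Fin d) : ℂ :=
  (∏ k', (c.1 j - c.2 k')) / (a * ∏ k ∈ Finset.univ.erase j, (c.1 j - c.1 k))

/-- The set of nondegenerate configurations: all `2d-2` coordinates pairwise
distinct, and every proper nonempty residue subsum has nonzero real part. -/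
noncomputable def nondegResidueSet (d : ℕ) (a : ℂ) :
    Set ((Fin d → ℂ) × (Fin (d - 2) → ℂ)) :=
  {c | Function.Injective (Sum.elim c.1 c.2) ∧
    ∀ J : Finset (Fin d), J ≠ ∅ → J ≠ Finset.univ →
      (∑ j ∈ J, rationalResidue d a c j).re ≠ 0}

open Filter Topology

/-- A sum of simple fractions with distinct poles is not locally constant. -/
lemma not_eventually_const {ι : Type*} [DecidableEq ι] (J : Finset ι) (A e : ι → ℂ)
    (he : Function.Injective e) (j0 : ι) (hj0 : j0 ∈ J) (hA : A j0 ≠ 0) (z0 w : ℂ)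
    (hz : ∀ j ∈ J, e j ≠ z0) :
    ¬ ∀ᶠ z in 𝓝 z0, ∑ j ∈ J, A j / (e j - z) = w := by
  intro h
  have h2 : ∀ᶠ z in 𝓝 z0, ∀ j ∈ J, e j ≠ z := by
    rw [Filter.eventually_all_finset]
    intro j hj
    filter_upwards [isOpen_ne.mem_nhds (hz j hj).symm] with z hz using Ne.symm hz
  let q : Polynomial ℂ :=
    ∑ j ∈ J, Polynomial.C (A j) * ∏ i ∈ J.erase j, (Polynomial.C (e i) - Polynomial.X)
      - Polynomial.C w * ∏ i ∈ J, (Polynomial.C (e i) - Polynomial.X)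
  have hq : q = 0 := by
    apply Polynomial.eq_zero_of_infinite_isRoot
    refine (infinite_of_mem_nhds z0 (h.and h2)).mono ?_
    rintro z ⟨h1, h2⟩
    simp only [Set.mem_ofPred_eq, Polynomial.IsRoot.def, q, Polynomial.eval_sub,
      Polynomial.eval_finsetSum, Polynomial.eval_mul, Polynomial.eval_C, Polynomial.eval_prod,
      Polynomial.eval_X]
    rw [← h1, Finset.sum_mul, sub_eq_zero]
    refine Finset.sum_congr rfl fun j hj => ?_
    rw [← Finset.mul_prod_erase J _ hj]
    have := sub_ne_zero.2 (h2 j hj)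
    field_simp
  have h3 : q.eval (e j0) = 0 := by rw [hq]; simp
  simp only [q, Polynomial.eval_sub,
      Polynomial.eval_finsetSum, Polynomial.eval_mul, Polynomial.eval_C, Polynomial.eval_prod,
      Polynomial.eval_X] at h3
  rw [Finset.prod_eq_zero hj0 (sub_self _), mul_zero, sub_zero,
    Finset.sum_eq_single_of_mem j0 hj0] at h3
  · refine mul_ne_zero hA ?_ h3
    refine Finset.prod_ne_zero_iff.2 fun i hi => sub_ne_zero.2 ?_
    exact fun hh => (Finset.mem_erase.1 hi).1 (he hh)
  · intro j hj hne
    rw [Finset.prod_eq_zero (i := j0) (Finset.mem_erase.2 ⟨hne.symm, hj0⟩) (sub_self _), mul_zero]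

/-- Such a sum has nonzero real part frequently near any regular point. -/
lemma frequently_re_ne {ι : Type*} [DecidableEq ι] (J : Finset ι) (A e : ι → ℂ)
    (he : Function.Injective e) (j0 : ι) (hj0 : j0 ∈ J) (hA : A j0 ≠ 0) (z0 : ℂ)
    (hz : ∀ j ∈ J, e j ≠ z0) :
    ∃ᶠ z in 𝓝 z0, (∑ j ∈ J, A j / (e j - z)).re ≠ 0 := by
  intro h
  simp only [ne_eq, not_not] at h
  have han : AnalyticAt ℂ (fun z => ∑ j ∈ J, A j / (e j - z)) z0 := by
    refine Finset.analyticAt_fun_sum J fun j hj => ?_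
    exact analyticAt_const.div (analyticAt_const.sub analyticAt_id) (sub_ne_zero.2 (hz j hj))
  rcases han.eventually_constant_or_nhds_le_map_nhds with h1 | h1
  · exact not_eventually_const J A e he j0 hj0 hA z0 _ hz h1
  · have h2 : ∀ᶠ w in 𝓝 (∑ j ∈ J, A j / (e j - z0)), w.re = 0 := h1 h
    generalize (∑ j ∈ J, A j / (e j - z0)) = w at h2
    have ht : Tendsto (fun t : ℝ => w + t) (𝓝[≠] 0) (𝓝 w) := by
      have : Continuous (fun t : ℝ => w + (t : ℂ)) := by fun_prop
      have := this.tendsto 0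
      simp only [Complex.ofReal_zero, add_zero] at this
      exact this.mono_left nhdsWithin_le_nhds
    obtain ⟨t, ht1, ht2⟩ := ((ht.eventually h2).and self_mem_nhdsWithin).exists
    have h0 := h2.self_of_nhds
    simp [h0] at ht1
    exact ht2 ht1

/-- The injective configurations. -/
def injSet (d : ℕ) : Set ((Fin d → ℂ) × (Fin (d - 2) → ℂ)) :=
  {c | Function.Injective (Sum.elim c.1 c.2)}

lemma injSet_eq (d : ℕ) : injSet d = ⋂ q : {q : (Fin d ⊕ Fin (d - 2)) × (Fin d ⊕ Fin (d - 2)) // q.1 ≠ q.2},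
    {c | Sum.elim c.1 c.2 q.1.1 - Sum.elim c.1 c.2 q.1.2 ≠ 0} := by
  ext c
  simp only [injSet, Set.mem_ofPred_eq, Set.mem_iInter, Subtype.forall, Prod.forall, sub_ne_zero]
  exact ⟨fun h a b hab => h.ne hab, fun h a b hab => by_contra fun hne => h a b hne hab⟩

lemma cont_elim (d : ℕ) (i : Fin d ⊕ Fin (d - 2)) :
    Continuous fun c : (Fin d → ℂ) × (Fin (d - 2) → ℂ) => Sum.elim c.1 c.2 i := by
  rcases i with i | i <;> simp only [Sum.elim_inl, Sum.elim_inr] <;> fun_prop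

lemma isOpen_diff (d : ℕ) (i k : Fin d ⊕ Fin (d - 2)) :
    IsOpen {c : (Fin d → ℂ) × (Fin (d - 2) → ℂ) |
      Sum.elim c.1 c.2 i - Sum.elim c.1 c.2 k ≠ 0} :=
  isOpen_ne.preimage ((cont_elim d i).sub (cont_elim d k))

lemma dense_diff (d : ℕ) (i k : Fin d ⊕ Fin (d - 2)) (hik : i ≠ k) :
    Dense {c : (Fin d → ℂ) × (Fin (d - 2) → ℂ) |
      Sum.elim c.1 c.2 i - Sum.elim c.1 c.2 k ≠ 0} := by
  let φ : ((Fin d → ℂ) × (Fin (d - 2) → ℂ)) →L[ℂ] ℂ :=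
    { toFun := fun c => Sum.elim c.1 c.2 i - Sum.elim c.1 c.2 k
      map_add' := by
        intro x y
        rcases i with i | i <;> rcases k with k | k <;> simp <;> ring
      map_smul' := by
        intro x y
        rcases i with i | i <;> rcases k with k | k <;> simp <;> ring
      cont := (cont_elim d i).sub (cont_elim d k) }
  have hs : Function.Surjective φ := by
    intro w
    let x : Fin d ⊕ Fin (d - 2) → ℂ := Pi.single i w
    refine ⟨(x ∘ Sum.inl, x ∘ Sum.inr), ?_⟩
    change Sum.elim (x ∘ Sum.inl) (x ∘ Sum.inr) i - Sum.elim (x ∘ Sum.inl) (x ∘ Sum.inr) k = w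
    rw [Sum.elim_comp_inl_inr]
    simp [x, hik.symm]
  exact (dense_compl_singleton (0 : ℂ)).preimage (φ.isOpenMap hs)

lemma isOpen_injSet (d : ℕ) : IsOpen (injSet d) := by
  rw [injSet_eq]
  exact isOpen_iInter_of_finite fun q => isOpen_diff d _ _

lemma dense_injSet (d : ℕ) : Dense (injSet d) := by
  rw [injSet_eq]
  exact dense_iInter_of_isOpen (fun q => isOpen_diff d _ _) fun q => dense_diff d _ _ q.2

/-- Injective configurations with nonzero real part of the subsum over `J`. -/
def goodSet (d : ℕ) (a : ℂ) (J : Finset (Fin d)) : Set ((Fin d → ℂ) × (Fin (d - 2) → ℂ)) :=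
  injSet d ∩ {c | (∑ j ∈ J, rationalResidue d a c j).re ≠ 0}

lemma isOpen_goodSet (d : ℕ) (a : ℂ) (ha : a ≠ 0) (J : Finset (Fin d)) :
    IsOpen (goodSet d a J) := by
  have hc : ContinuousOn (fun c => (∑ j ∈ J, rationalResidue d a c j).re) (injSet d) := by
    refine Complex.continuous_re.comp_continuousOn ?_
    refine continuousOn_finset_sum J fun j _ => ?_
    unfold rationalResidue
    refine ContinuousOn.div (by fun_prop) (by fun_prop) ?_
    intro c hc
    refine mul_ne_zero ha (Finset.prod_ne_zero_iff.2 fun k hk => sub_ne_zero.2 fun h => ?_)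
    have h2 : (Sum.inl j : Fin d ⊕ Fin (d - 2)) = Sum.inl k := hc (by simpa using h)
    exact (Finset.mem_erase.1 hk).1 (Sum.inl_injective h2).symm
  exact hc.isOpen_inter_preimage (isOpen_injSet d) isOpen_ne

lemma dense_goodSet (d : ℕ) (a : ℂ) (ha : a ≠ 0) (J : Finset (Fin d)) (h1 : J ≠ ∅)
    (h2 : J ≠ Finset.univ) : Dense (goodSet d a J) := by
  have key : injSet d ⊆ closure (goodSet d a J) := by
    intro c hc
    obtain ⟨j0, hj0⟩ := Finset.nonempty_iff_ne_empty.2 h1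
    obtain ⟨l, hl⟩ : ∃ l, l ∉ J := by
      by_contra! h
      exact h2 (Finset.eq_univ_iff_forall.2 h)
    have hinj : Function.Injective c.1 := fun x y h =>
      Sum.inl_injective (hc (a₁ := Sum.inl x) (a₂ := Sum.inl y) (by simpa using h))
    have hne : ∀ j ∈ J, j ≠ l := fun j hj h => hl (h ▸ hj)
    let γ : ℂ → (Fin d → ℂ) × (Fin (d - 2) → ℂ) := fun z => (Function.update c.1 l z, c.2)
    have hγ : Continuous γ := by fun_prop
    have hγ0 : γ (c.1 l) = c := by simp [γ]
    let A : Fin d → ℂ := fun j => (∏ k', (c.1 j - c.2 k')) /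
      (a * ∏ k ∈ (Finset.univ.erase j).erase l, (c.1 j - c.1 k))
    have hA : A j0 ≠ 0 := by
      refine div_ne_zero (Finset.prod_ne_zero_iff.2 fun k _ => sub_ne_zero.2 fun h => ?_)
        (mul_ne_zero ha (Finset.prod_ne_zero_iff.2 fun k hk => sub_ne_zero.2 fun h => ?_))
      · have := hc (a₁ := Sum.inl j0) (a₂ := Sum.inr k) (by simpa using h)
        simp at this
      · simp only [Finset.mem_erase] at hk
        exact hk.2.1 (hinj h).symm
    have hsum : ∀ z, ∑ j ∈ J, rationalResidue d a (γ z) j = ∑ j ∈ J, A j / (c.1 j - z) := by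
      intro z
      refine Finset.sum_congr rfl fun j hj => ?_
      have hjl := hne j hj
      have hp : ∏ k ∈ Finset.univ.erase j, ((γ z).1 j - (γ z).1 k)
          = (c.1 j - z) * ∏ k ∈ (Finset.univ.erase j).erase l, (c.1 j - c.1 k) := by
        rw [← Finset.mul_prod_erase _ _
          (Finset.mem_erase.2 ⟨hjl.symm, Finset.mem_univ l⟩)]
        congr 1
        · simp [γ, hjl]
        · refine Finset.prod_congr rfl fun k hk => ?_
          simp [γ, hjl, (Finset.mem_erase.1 hk).1]
      unfold rationalResidue
      rw [hp]
      simp only [A, γ, Function.update_of_ne hjl]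
      rw [div_div]
      congr 1
      ring
    have hf := frequently_re_ne J A c.1 hinj j0 hj0 hA (c.1 l)
      (fun j hj h => hne j hj (hinj h))
    have ht : Tendsto γ (𝓝 (c.1 l)) (𝓝 c) := by
      have := hγ.tendsto (c.1 l)
      rwa [hγ0] at this
    have hI : ∀ᶠ z in 𝓝 (c.1 l), γ z ∈ injSet d := ht ((isOpen_injSet d).mem_nhds hc)
    rw [mem_closure_iff_frequently]
    refine ht.frequently ((hf.and_eventually hI).mono ?_)
    rintro z ⟨hz1, hz2⟩
    refine ⟨hz2, ?_⟩
    change (∑ j ∈ J, rationalResidue d a (γ z) j).re ≠ 0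
    rwa [hsum]
  exact fun x => closure_minimal key isClosed_closure (dense_injSet d x)

theorem stmt0 (d : ℕ) (hd : 2 ≤ d) (a : ℂ) (ha : a ≠ 0) :
    IsOpen (nondegResidueSet d a) ∧ Dense (nondegResidueSet d a) := by
  have heq : nondegResidueSet d a = injSet d ∩
      ⋂ J : {J : Finset (Fin d) // J ≠ ∅ ∧ J ≠ Finset.univ}, goodSet d a J.1 := by
    ext c
    simp only [nondegResidueSet, goodSet, injSet, Set.mem_ofPred_eq, Set.mem_inter_iff,
      Set.mem_iInter, Subtype.forall]
    exact ⟨fun h => ⟨h.1, fun J hJ => ⟨h.1, h.2 J hJ.1 hJ.2⟩⟩,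
      fun h => ⟨h.1, fun J h1 h2 => (h.2 J ⟨h1, h2⟩).2⟩⟩
  have ho : IsOpen (⋂ J : {J : Finset (Fin d) // J ≠ ∅ ∧ J ≠ Finset.univ}, goodSet d a J.1) :=
    isOpen_iInter_of_finite fun J => isOpen_goodSet d a ha J.1
  rw [heq]
  refine ⟨(isOpen_injSet d).inter ho, ?_⟩
  refine (dense_injSet d).inter_of_isOpen_left ?_ (isOpen_injSet d)
  exact dense_iInter_of_isOpen (fun J => isOpen_goodSet d a ha J.1)
    fun J => dense_goodSet d a ha J.1 J.2.1 J.2.2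
end

section
/- Let d ≥ 2 and let η : Fin d → ℂ satisfy: η_j ≠ 0 for all j; ∑_{j} η_j = 0; and ∑_{j ∈ J} η_j ≠ 0 for every subset J ⊆ Fin d with J ≠ ∅ and J ≠ Fin d. Then there exists an injective map e : Fin d → ℂ such that for the monic polynomial P(w) = ∏_{j} (w − e_j) one has η_j = 1/P'(e_j) for every j, i.e. η_j · ∏_{k ≠ j} (e_j − e_k) = 1 for all j ∈ Fin d. -/
open Finset

/-- Prime chain in the polynomial ring. -/
lemma aux_height (n k : ℕ) (hk : k ≤ n) :
    (k : ℕ∞) ≤ (RingHom.ker (MvPolynomial.aeval (R := ℂ)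
      (fun i : Fin n => if (i : ℕ) < k then (0 : MvPolynomial (Fin n) ℂ)
        else MvPolynomial.X i))).height := by
  induction k with
  | zero => simp
  | succ k ih =>
    have ih := ih (by omega)
    have hp1 : ∀ m : ℕ, (RingHom.ker (MvPolynomial.aeval (R := ℂ)
      (fun i : Fin n => if (i : ℕ) < m then (0 : MvPolynomial (Fin n) ℂ)
        else MvPolynomial.X i))).IsPrime := fun m => RingHom.ker_isPrime _
    have hpk := hp1 k
    have hpk' := hp1 (k + 1)
    refine le_trans ?_ (Ideal.height_add_one_le_of_lt_of_isPrime (I := RingHom.ker (MvPolynomial.aeval (R := ℂ)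
      (fun i : Fin n => if (i : ℕ) < k then (0 : MvPolynomial (Fin n) ℂ)
        else MvPolynomial.X i))) ?_)
    · push_cast
      gcongr
    · refine lt_of_le_of_ne ?_ ?_
      · intro p hp
        rw [RingHom.mem_ker] at hp ⊢
        have := congrArg (MvPolynomial.aeval (R := ℂ)
          (fun i : Fin n => if (i : ℕ) < k + 1 then (0 : MvPolynomial (Fin n) ℂ)
            else MvPolynomial.X i)) hp
        rw [map_zero] at this
        refine Eq.trans ?_ this
        rw [← AlgHom.comp_apply]
        congr 1
        apply MvPolynomial.algHom_ext
        intro i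
        simp only [MvPolynomial.aeval_X, AlgHom.comp_apply]
        by_cases h1 : (i : ℕ) < k
        · rw [if_pos h1, if_pos (by omega), map_zero]
        · rw [if_neg h1, MvPolynomial.aeval_X]
      · intro h
        have h2 : (MvPolynomial.X ⟨k, by omega⟩ : MvPolynomial (Fin n) ℂ) ∈
            RingHom.ker (MvPolynomial.aeval (R := ℂ)
            (fun i : Fin n => if (i : ℕ) < k + 1 then (0 : MvPolynomial (Fin n) ℂ)
            else MvPolynomial.X i)) := by
          rw [RingHom.mem_ker]; simp
        rw [← h, RingHom.mem_ker] at h2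
        simp at h2

/-- `n` polynomials in `n+1` variables vanishing at `0` have a nonzero common zero. -/
lemma aux_zero (n : ℕ) (f : Fin n → MvPolynomial (Fin (n + 1)) ℂ)
    (hf : ∀ k, MvPolynomial.aeval (0 : Fin (n + 1) → ℂ) (f k) = 0) :
    ∃ x : Fin (n + 1) → ℂ, x ≠ 0 ∧ ∀ k, MvPolynomial.aeval x (f k) = 0 := by
  by_contra! hcon
  set M := RingHom.ker (MvPolynomial.aeval (R := ℂ)
      (fun i : Fin (n + 1) => if (i : ℕ) < n + 1 then (0 : MvPolynomial (Fin (n + 1)) ℂ)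
        else MvPolynomial.X i)) with hM
  have hMprime : M.IsPrime := RingHom.ker_isPrime _
  have hmem : ∀ p, p ∈ M ↔ MvPolynomial.aeval (0 : Fin (n + 1) → ℂ) p = 0 := by
    intro p
    have : (fun i : Fin (n + 1) => if (i : ℕ) < n + 1 then (0 : MvPolynomial (Fin (n + 1)) ℂ)
        else MvPolynomial.X i) = 0 := by
      funext i; simp only [i.isLt, if_true, Pi.zero_apply]
    rw [hM, RingHom.mem_ker, this, MvPolynomial.aeval_zero, MvPolynomial.aeval_zero]
    simp [MvPolynomial.algebraMap_eq]
  have hh := aux_height (n + 1) (n + 1) le_rfl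
  rw [← hM] at hh
  have hle : Ideal.span (Set.range f) ≤ M := by
    rw [Ideal.span_le]
    rintro _ ⟨k, rfl⟩
    exact (hmem _).2 (hf k)
  have hrad : M ≤ (Ideal.span (Set.range f)).radical := by
    rw [← MvPolynomial.vanishingIdeal_zeroLocus_eq_radical (K := ℂ)]
    intro p hp
    rw [MvPolynomial.mem_vanishingIdeal_iff]
    intro x hx
    have hx0 : x = 0 := by
      by_contra h
      obtain ⟨k, hk⟩ := hcon x h
      exact hk (MvPolynomial.mem_zeroLocus_iff.1 hx _ (Ideal.subset_span ⟨k, rfl⟩))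
    rw [hx0]
    exact (hmem p).1 hp
  have hmin : M ∈ (Ideal.span (Set.range f)).minimalPrimes := by
    refine ⟨⟨hMprime, hle⟩, ?_⟩
    rintro q ⟨hq, hq2⟩ _
    exact hrad.trans (hq.radical_le_iff.2 hq2)
  classical
  have hc := Ideal.height_le_card_of_mem_minimalPrimes_span_finset
    (s := Finset.univ.image f) (p := M) (by simpa using hmin)
  have h1 : (Finset.univ.image f).card ≤ n := by
    simpa using Finset.card_image_le (s := (Finset.univ : Finset (Fin n))) (f := f)
  have h2 := hh.trans hc
  norm_cast at h2
  omega

lemma aux_functional (d : ℕ) (η e : Fin (d + 1) → ℂ)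
    (h : ∀ k < d, ∑ j, η j * e j ^ k = 0) (q : Polynomial ℂ) (hq : q.natDegree ≤ d) :
    ∑ j, η j * q.eval (e j) = q.coeff d * ∑ j, η j * e j ^ d := by
  have : ∀ j, η j * q.eval (e j) = ∑ i ∈ range (d + 1), q.coeff i * (η j * e j ^ i) := by
    intro j
    rw [Polynomial.eval_eq_sum_range' (Nat.lt_succ_of_le hq), Finset.mul_sum]
    exact Finset.sum_congr rfl fun i _ => by ring
  simp_rw [this]
  rw [Finset.sum_comm, Finset.sum_range_succ]
  simp_rw [← Finset.mul_sum]
  rw [Finset.sum_eq_zero, zero_add]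
  intro i hi
  rw [h i (Finset.mem_range.1 hi), mul_zero]

theorem stmt2 (d : ℕ) (hd : 2 ≤ d) (η : Fin d → ℂ)
    (hne : ∀ j, η j ≠ 0) (hsum : ∑ j, η j = 0)
    (hJ : ∀ J : Finset (Fin d), J ≠ ∅ → J ≠ Finset.univ → ∑ j ∈ J, η j ≠ 0) :
    ∃ e : Fin d → ℂ, Function.Injective e ∧
      ∀ j, η j * ∏ k ∈ Finset.univ.erase j, (e j - e k) = 1 := by
  classical
  obtain ⟨n, rfl⟩ : ∃ n, d = n + 1 + 1 := ⟨d - 2, by omega⟩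
  obtain ⟨x, hx0, hx⟩ := aux_zero n
    (fun k => ∑ i : Fin (n + 1), MvPolynomial.C (η i.succ) * MvPolynomial.X i ^ ((k : ℕ) + 1))
    (by intro k; simp)
  set e : Fin (n + 1 + 1) → ℂ := Fin.cons 0 x with he
  have hpow : ∀ k < n + 1, ∑ j, η j * e j ^ k = 0 := by
    intro k hk
    rcases k with _ | k
    · simpa using hsum
    · have := hx ⟨k, by omega⟩
      rw [Fin.sum_univ_succ]
      simpa [he, MvPolynomial.algebraMap_eq] using this
  have hL := aux_functional (n + 1) η e hpow
  have hinj : Function.Injective e := by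
    by_contra hni
    have hcard : (Finset.univ.image e).card ≤ n + 1 := by
      have h1 : (Finset.univ.image e).card ≤ n + 1 + 1 := by
        simpa using Finset.card_image_le (s := (Finset.univ : Finset (Fin (n + 1 + 1)))) (f := e)
      have h2 : (Finset.univ.image e).card ≠ n + 1 + 1 := by
        intro h
        apply hni
        rw [← Set.injOn_univ, ← Finset.coe_univ]
        apply Finset.card_image_iff.1
        simpa using h
      omega
    have hz : (0 : ℂ) ∈ Finset.univ.image e := Finset.mem_image.2 ⟨0, by simp, by simp [he]⟩
    set Q : Polynomial ℂ := ∏ u ∈ (Finset.univ.image e).erase 0, (Polynomial.X - Polynomial.C u)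
      with hQ
    have hdeg : Q.natDegree < n + 1 := by
      rw [hQ, Polynomial.natDegree_finsetProd_X_sub_C_eq_card, Finset.card_erase_of_mem hz]
      have := Finset.card_pos.2 ⟨_, hz⟩
      omega
    have h1 := hL Q hdeg.le
    rw [Polynomial.coeff_eq_zero_of_natDegree_lt hdeg, zero_mul] at h1
    have hQ0 : Q.eval 0 ≠ 0 := by
      rw [hQ, Polynomial.eval_prod, Finset.prod_ne_zero_iff]
      intro u hu
      have := Finset.ne_of_mem_erase hu
      simpa using this
    have h2 : ∑ j ∈ Finset.univ.filter (fun j => e j = 0), η j = 0 := by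
      apply mul_right_cancel₀ hQ0
      rw [zero_mul, Finset.sum_mul, Finset.sum_filter]
      refine Eq.trans ?_ h1
      apply Finset.sum_congr rfl
      intro j _
      split_ifs with h
      · rw [h]
      · have : Q.eval (e j) = 0 := by
          rw [hQ, Polynomial.eval_prod]
          exact Finset.prod_eq_zero (i := e j) (by simp [h]) (by simp)
        rw [this, mul_zero]
    refine hJ _ ?_ ?_ h2
    · apply Finset.Nonempty.ne_empty
      exact ⟨0, by simp [he]⟩
    · intro h
      apply hx0
      funext i
      have : i.succ ∈ Finset.univ.filter (fun j => e j = 0) := by rw [h]; simp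
      simpa [he] using this
  set S := ∑ j, η j * e j ^ (n + 1) with hS
  have hprod : ∀ j, η j * ∏ k ∈ Finset.univ.erase j, (e j - e k) = S := by
    intro j
    set Q : Polynomial ℂ := ∏ k ∈ Finset.univ.erase j, (Polynomial.X - Polynomial.C (e k)) with hQ
    have hdeg : Q.natDegree = n + 1 := by
      rw [hQ, Polynomial.natDegree_finsetProd_X_sub_C_eq_card]
      simp
    have hmon : Q.Monic := Polynomial.monic_prod_of_monic _ _ fun k _ => Polynomial.monic_X_sub_C _
    have h1 := hL Q hdeg.le
    have hco : Q.coeff (n + 1) = 1 := by rw [← hmon.coeff_natDegree, hdeg]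
    rw [hco, one_mul] at h1
    rw [← h1, Finset.sum_eq_single j]
    · rw [hQ, Polynomial.eval_prod]; simp
    · intro i _ hij
      rw [hQ, Polynomial.eval_prod, Finset.prod_eq_zero (i := i) (by simp [hij]) (by simp), mul_zero]
    · simp
  have hS0 : S ≠ 0 := by
    rw [← hprod 0]
    refine mul_ne_zero (hne 0) (Finset.prod_ne_zero_iff.2 fun k hk => ?_)
    rw [sub_ne_zero]
    exact fun h => Finset.ne_of_mem_erase hk (hinj h).symm
  obtain ⟨c, hc⟩ := IsAlgClosed.exists_pow_nat_eq S⁻¹ (Nat.succ_pos n)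
  have hc0 : c ≠ 0 := by
    rintro rfl
    rw [zero_pow (Nat.succ_ne_zero n)] at hc
    exact inv_ne_zero hS0 hc.symm
  refine ⟨fun j => c * e j, fun a b hab => hinj (mul_left_cancel₀ hc0 hab), fun j => ?_⟩
  simp_rw [← mul_sub]
  rw [Finset.prod_mul_distrib, Finset.prod_const, Finset.card_erase_of_mem (Finset.mem_univ _)]
  simp only [Finset.card_univ, Fintype.card_fin, Nat.add_sub_cancel]
  rw [mul_left_comm, hprod j]
  have : c ^ (n + 1) = S⁻¹ := hc
  rw [this, inv_mul_cancel₀ hS0]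
end
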